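/- arXiv:2503.10155 — 2 statements merged into one kernel-verified Lean document; each statement's English description precedes it below -/
import Mathlib

section
/- Let f be self-concordant on an open convex set D ⊆ E, and let x ∈ D be a point where ∇²f(x) is positive definite. Then for every y ∈ D with r := ‖y − x‖_x < 1, one has ‖∇f(y) − ∇f(x) − ∇²f(x)(y − x)‖_x^* ≤ r²/(1 − r). -/
open scoped RealInnerProductSpace

/-- The Hessian of `f` at `x`, as a linear operator on `E` (with respect to the inner product):
the Fréchet derivative of the gradient. -/
noncomputable def hessOp {E : Type*} [NormedAddCommGroup E] [InnerProductSpace ℝ E]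
    [CompleteSpace E] (f : E → ℝ) (x : E) : E →L[ℝ] E :=
  fderiv ℝ (gradient f) x

/-- `f` is self-concordant on the open convex set `D`: it is three times continuously
differentiable on `D` and `D³f(x)[h,h,h] ≤ 2 (D²f(x)[h,h])^{3/2}` for all `x ∈ D`, `h ∈ E`. -/
def SelfConcordantOn {E : Type*} [NormedAddCommGroup E] [InnerProductSpace ℝ E]
    (f : E → ℝ) (D : Set E) : Prop :=
  IsOpen D ∧ Convex ℝ D ∧ ContDiffOn ℝ 3 f D ∧
    ∀ x ∈ D, ∀ h : E,
      iteratedFDeriv ℝ 3 f x (fun _ => h) ≤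
        2 * (iteratedFDeriv ℝ 2 f x (fun _ => h)) ^ ((3 : ℝ) / 2)

theorem cubic_quadrature_identity (a b c d x y q : ℝ) (hxy : x ^ 2 + y ^ 2 = 1)
    (hq : q ^ 2 = 3) (P : ℝ → ℝ → ℝ)
    (hP : ∀ u v, P u v = a * u ^ 3 + 3 * b * u ^ 2 * v + 3 * c * u * v ^ 2 + d * v ^ 3) :
    a * (4 * x ^ 3 - 3 * x) + b * (3 * y - 4 * y ^ 3) =
      (3 - 4 * y ^ 2) ^ 2 / 9 * P x y
      - (3 - 4 * (y / 2 + q / 2 * x) ^ 2) ^ 2 / 9 * P (x / 2 - q / 2 * y) (y / 2 + q / 2 * x)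
      - (3 - 4 * (y / 2 - q / 2 * x) ^ 2) ^ 2 / 9 *
        P (x / 2 + q / 2 * y) (y / 2 - q / 2 * x) := by
  simp only [hP]
  grind

theorem cubic_weights_sum (x y q : ℝ) (hxy : x ^ 2 + y ^ 2 = 1) (hq : q ^ 2 = 3) :
    (3 - 4 * y ^ 2) ^ 2 / 9 + (3 - 4 * (y / 2 + q / 2 * x) ^ 2) ^ 2 / 9
      + (3 - 4 * (y / 2 - q / 2 * x) ^ 2) ^ 2 / 9 = 1 := by
  grind

/-- A cubic form in two variables bounded by `M` on the unit circle has
`a² + b² ≤ M²`, where `a` and `3b` are its two leading coefficients. -/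
theorem sq_add_sq_le_of_cubic_le (a b c d M : ℝ)
    (h : ∀ u v : ℝ, u ^ 2 + v ^ 2 = 1 →
      |a * u ^ 3 + 3 * b * u ^ 2 * v + 3 * c * u * v ^ 2 + d * v ^ 3| ≤ M) :
    a ^ 2 + b ^ 2 ≤ M ^ 2 := by
  set z : ℂ := ⟨a, b⟩ with hz
  set θ := z.arg / 3 with hθ
  have h3 : z.arg = 3 * θ := by rw [hθ]; ring
  have ha : ‖z‖ * Real.cos (3 * θ) = a := by rw [← h3]; exact Complex.norm_mul_cos_arg z
  have hb : ‖z‖ * Real.sin (3 * θ) = b := by rw [← h3]; exact Complex.norm_mul_sin_arg z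
  have hn : ‖z‖ = a * Real.cos (3 * θ) + b * Real.sin (3 * θ) := by
    conv_rhs => rw [← ha, ← hb]
    linear_combination -‖z‖ * Real.sin_sq_add_cos_sq (3 * θ)
  have hsq : a ^ 2 + b ^ 2 = ‖z‖ ^ 2 := by
    conv_lhs => rw [← ha, ← hb]
    linear_combination ‖z‖ ^ 2 * Real.sin_sq_add_cos_sq (3 * θ)
  rw [hsq]
  refine pow_le_pow_left₀ (norm_nonneg _) ?_ 2
  rw [hn, Real.cos_three_mul, Real.sin_three_mul]
  set x := Real.cos θ
  set y := Real.sin θ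
  have hxy : x ^ 2 + y ^ 2 = 1 := Real.cos_sq_add_sin_sq θ
  set q := Real.sqrt 3
  have hq : q ^ 2 = 3 := Real.sq_sqrt (by norm_num)
  rw [cubic_quadrature_identity a b c d x y q hxy hq _ (fun _ _ => rfl)]
  have hs := cubic_weights_sum x y q hxy hq
  have e0 := h x y hxy
  have e1 := h (x / 2 - q / 2 * y) (y / 2 + q / 2 * x)
    (by linear_combination (1 / 4 + q ^ 2 / 4) * hxy + hq / 4)
  have e2 := h (x / 2 + q / 2 * y) (y / 2 - q / 2 * x)
    (by linear_combination (1 / 4 + q ^ 2 / 4) * hxy + hq / 4)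
  have w0 : 0 ≤ (3 - 4 * y ^ 2) ^ 2 / 9 := by positivity
  have w1 : 0 ≤ (3 - 4 * (y / 2 + q / 2 * x) ^ 2) ^ 2 / 9 := by positivity
  have w2 : 0 ≤ (3 - 4 * (y / 2 - q / 2 * x) ^ 2) ^ 2 / 9 := by positivity
  have f0 := mul_le_mul_of_nonneg_left (abs_le.1 e0).2 w0
  have f1 := mul_le_mul_of_nonneg_left (abs_le.1 e1).1 w1
  have f2 := mul_le_mul_of_nonneg_left (abs_le.1 e2).1 w2
  have hM : M = ((3 - 4 * y ^ 2) ^ 2 / 9 + (3 - 4 * (y / 2 + q / 2 * x) ^ 2) ^ 2 / 9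
      + (3 - 4 * (y / 2 - q / 2 * x) ^ 2) ^ 2 / 9) * M := by rw [hs, one_mul]
  linarith

section Forms

variable {E : Type*} [NormedAddCommGroup E] [NormedSpace ℝ E]

/-- A symmetric trilinear form dominated on the diagonal by a Euclidean norm is dominated by it
with the same constant off the diagonal. -/
theorem abs_trilinear_le (T : E →L[ℝ] E →L[ℝ] E →L[ℝ] ℝ) (H : E →L[ℝ] E →L[ℝ] ℝ) (M : ℝ)
    (T12 : ∀ u v w, T u v w = T v u w) (T23 : ∀ u v w, T u v w = T u w v)
    (Hs : ∀ u v, H u v = H v u) (Hp : ∀ u, u ≠ 0 → 0 < H u u)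
    (hT : ∀ h, H h h ≤ 1 → |T h h h| ≤ M) (d u : E) :
    |T d u u| ≤ M * Real.sqrt (H d d) * H u u := by
  have Hn : ∀ u, 0 ≤ H u u := fun u => by
    by_cases h : u = 0
    · simp [h]
    · exact (Hp u h).le
  by_cases hu : u = 0
  · simp [hu]
  have hU := Hp u hu
  set U := Real.sqrt (H u u) with hUdef
  have hUpos : 0 < U := Real.sqrt_pos.2 hU
  have hUsq : U ^ 2 = H u u := Real.sq_sqrt hU.le
  set u1 : E := U⁻¹ • u with hu1
  have huu1 : u = U • u1 := by rw [hu1, smul_smul, mul_inv_cancel₀ hUpos.ne', one_smul]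
  have H11 : H u1 u1 = 1 := by
    simp only [hu1, map_smul, smul_apply, smul_eq_mul]
    rw [← hUsq]; field_simp
  set κ := H d u1 with hκ
  set e : E := d - κ • u1 with he
  have hde : d = κ • u1 + e := by rw [he]; abel
  have H1e : H u1 e = 0 := by
    simp only [he, map_sub, map_smul, smul_eq_mul, H11]
    rw [Hs u1 d]; ring
  have Hdd : H d d = κ ^ 2 + H e e := by
    rw [hde]
    simp only [map_add, map_smul, smul_apply, smul_eq_mul,
      add_apply, H11, H1e, Hs e u1]
    ring
  set μ := Real.sqrt (H e e) with hμ
  have hμsq : μ ^ 2 = H e e := Real.sq_sqrt (Hn e)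
  set e1 : E := μ⁻¹ • e with he1
  have hee1 : e = μ • e1 := by
    by_cases h : e = 0
    · simp [he1, h]
    · have : 0 < μ := Real.sqrt_pos.2 (Hp e h)
      rw [he1, smul_smul, mul_inv_cancel₀ this.ne', one_smul]
  have Hee1 : H e1 e1 ≤ 1 := by
    simp only [he1, map_smul, smul_apply, smul_eq_mul]
    rw [← hμsq]
    by_cases h : μ = 0
    · simp [h]
    · field_simp; exact le_refl _
  have H1e1 : H u1 e1 = 0 := by simp [he1, H1e]
  have key := sq_add_sq_le_of_cubic_le (T u1 u1 u1) (T u1 u1 e1) (T u1 e1 e1) (T e1 e1 e1) M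
    (by
      intro p q hpq
      have h1 : H (p • u1 + q • e1) (p • u1 + q • e1) ≤ 1 := by
        simp only [map_add, map_smul, smul_apply, smul_eq_mul,
          add_apply, H11, H1e1, Hs e1 u1]
        nlinarith [sq_nonneg q]
      have h2 := hT _ h1
      have h3 : T (p • u1 + q • e1) (p • u1 + q • e1) (p • u1 + q • e1) =
          T u1 u1 u1 * p ^ 3 + 3 * T u1 u1 e1 * p ^ 2 * q + 3 * T u1 e1 e1 * p * q ^ 2
            + T e1 e1 e1 * q ^ 3 := by
        simp only [map_add, map_smul, smul_apply, smul_eq_mul,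
          add_apply]
        rw [T12 e1 u1 u1, T23 u1 e1 u1, T23 e1 e1 u1, T12 e1 u1 e1]
        ring
      rwa [h3] at h2)
  have M0 : 0 ≤ M := (abs_nonneg _).trans (hT 0 (by simp))
  have hval : T d u u = (κ * T u1 u1 u1 + μ * T u1 u1 e1) * H u u := by
    rw [← hUsq]
    conv_lhs => rw [huu1, hde, hee1]
    simp only [map_add, map_smul, smul_apply, smul_eq_mul,
      add_apply]
    rw [T12 e1 u1 u1, T23 u1 e1 u1]
    ring
  rw [hval, abs_mul, abs_of_pos hU]
  refine mul_le_mul_of_nonneg_right ?_ hU.le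
  refine abs_le_of_sq_le_sq ?_ (by positivity)
  rw [mul_pow, Real.sq_sqrt (Hn d), Hdd, ← hμsq]
  nlinarith [sq_nonneg (κ * T u1 u1 e1 - μ * T u1 u1 u1),
    mul_le_mul_of_nonneg_right key (add_nonneg (sq_nonneg κ) (sq_nonneg μ))]

theorem abs_bilinear_le (B H : E →L[ℝ] E →L[ℝ] ℝ) (K : ℝ)
    (Bs : ∀ u v, B u v = B v u) (Hs : ∀ u v, H u v = H v u) (Hp : ∀ u, u ≠ 0 → 0 < H u u)
    (hB : ∀ u, |B u u| ≤ K * H u u) (u v : E) :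
    |B u v| ≤ K * Real.sqrt (H u u) * Real.sqrt (H v v) := by
  by_cases hu : u = 0
  · simp [hu]
  by_cases hv : v = 0
  · simp [hv]
  have hU := Hp u hu
  have hV := Hp v hv
  have a1 := Real.sq_sqrt hU.le
  have b1 := Real.sq_sqrt hV.le
  have a0 : 0 < Real.sqrt (H u u) := Real.sqrt_pos.2 hU
  have b0 : 0 < Real.sqrt (H v v) := Real.sqrt_pos.2 hV
  set a := Real.sqrt (H u u)
  set b := Real.sqrt (H v v)
  have p := abs_le.1 (hB (b • u + a • v))
  have m := abs_le.1 (hB (b • u - a • v))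
  simp only [map_add, map_sub, map_smul, smul_apply, smul_eq_mul,
    add_apply, sub_apply, Bs v u, Hs v u,
    ← a1, ← b1] at p m
  have hab : 0 < a * b := mul_pos a0 b0
  rw [abs_le]
  constructor
  · refine le_of_mul_le_mul_left ?_ hab
    nlinarith [p.1, m.2]
  · refine le_of_mul_le_mul_left ?_ hab
    nlinarith [p.2, m.1]

end Forms

theorem sqrt_le_of_deriv_le {φ φ' : ℝ → ℝ} {T r : ℝ} (hT : 0 ≤ T)
    (hd : ∀ t ∈ Set.Icc 0 T, HasDerivAt φ (φ' t) t) (hp : ∀ t ∈ Set.Icc 0 T, 0 < φ t)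
    (hb : ∀ t ∈ Set.Icc 0 T, φ' t ≤ 2 * Real.sqrt (φ t) * φ t)
    (hr : r = Real.sqrt (φ 0)) (hrT : r * T < 1) :
    Real.sqrt (φ T) ≤ r / (1 - r * T) := by
  have hD : ∀ t ∈ Set.Icc 0 T, HasDerivAt (fun t => (Real.sqrt (φ t))⁻¹ + t)
      (-(φ' t / (2 * Real.sqrt (φ t))) / Real.sqrt (φ t) ^ 2 + 1) t := fun t ht =>
    (((hd t ht).sqrt (hp t ht).ne').fun_inv (Real.sqrt_pos.2 (hp t ht)).ne').add (hasDerivAt_id t)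
  have mono : MonotoneOn (fun t => (Real.sqrt (φ t))⁻¹ + t) (Set.Icc 0 T) := by
    refine monotoneOn_of_deriv_nonneg (convex_Icc 0 T)
      (fun t ht => (hD t ht).continuousAt.continuousWithinAt) ?_ ?_
    · intro t ht
      exact (hD t (interior_subset ht)).differentiableAt.differentiableWithinAt
    · intro t ht
      have ht' := interior_subset ht
      rw [(hD t ht').deriv]
      have s := Real.sqrt_pos.2 (hp t ht')
      have s2 := Real.sq_sqrt (hp t ht').le
      have := hb t ht'
      have h3 : φ' t / (2 * Real.sqrt (φ t)) / Real.sqrt (φ t) ^ 2 ≤ 1 := by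
        rw [div_div, div_le_one (by positivity), s2]
        exact this
      rw [neg_div]; linarith
  have h0 : (0 : ℝ) ∈ Set.Icc 0 T := ⟨le_rfl, hT⟩
  have h1 : T ∈ Set.Icc 0 T := ⟨hT, le_rfl⟩
  have h := mono h0 h1 hT
  have r0 : 0 < r := hr ▸ Real.sqrt_pos.2 (hp 0 h0)
  have s := Real.sqrt_pos.2 (hp T h1)
  simp only [← hr, add_zero] at h
  have h2 : r⁻¹ - T ≤ (Real.sqrt (φ T))⁻¹ := by linarith
  have h3 : r⁻¹ - T = (1 - r * T) / r := by field_simp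
  rw [h3] at h2
  have h4 : 0 < (1 - r * T) / r := div_pos (by linarith) r0
  have := inv_anti₀ h4 h2
  rwa [inv_inv, inv_div] at this

theorem bounds_of_abs_deriv_le {φ φ' : ℝ → ℝ} {T r : ℝ} (hT : 0 ≤ T) (hr : 0 ≤ r)
    (hd : ∀ t ∈ Set.Icc 0 T, HasDerivAt φ (φ' t) t)
    (hb : ∀ t ∈ Set.Ioo 0 T, |φ' t| ≤ 2 * (r / (1 - r * t)) * φ t) (hrT : r * T < 1) :
    (1 - r * T) ^ 2 * φ 0 ≤ φ T ∧ (1 - r * T) ^ 2 * φ T ≤ φ 0 := by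
  have h0 : (0 : ℝ) ∈ Set.Icc 0 T := ⟨le_rfl, hT⟩
  have h1 : T ∈ Set.Icc 0 T := ⟨hT, le_rfl⟩
  have hq : ∀ t ∈ Set.Icc 0 T, 0 < 1 - r * t := fun t ht => by nlinarith [ht.2]
  have hlin : ∀ t : ℝ, HasDerivAt (fun t => (1 - r * t) ^ 2) (2 * (1 - r * t) * (-r)) t := by
    intro t
    exact ((((hasDerivAt_id t).const_mul r).const_sub 1).fun_pow 2).congr_deriv (by simp)
  have hb' : ∀ t ∈ Set.Ioo 0 T, (1 - r * t) * |φ' t| ≤ 2 * r * φ t := fun t ht => by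
    have q := hq t (Set.Ioo_subset_Icc_self ht)
    have := mul_le_mul_of_nonneg_left (hb t ht) q.le
    refine this.trans_eq ?_
    field_simp
  constructor
  · have hD : ∀ t ∈ Set.Icc 0 T, HasDerivAt (fun t => φ t / (1 - r * t) ^ 2)
        ((φ' t * (1 - r * t) ^ 2 - φ t * (2 * (1 - r * t) * (-r))) / ((1 - r * t) ^ 2) ^ 2) t :=
      fun t ht => (hd t ht).fun_div (hlin t) (pow_pos (hq t ht) 2).ne'
    have mono : MonotoneOn (fun t => φ t / (1 - r * t) ^ 2) (Set.Icc 0 T) := by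
      refine monotoneOn_of_deriv_nonneg (convex_Icc 0 T)
        (fun t ht => (hD t ht).continuousAt.continuousWithinAt)
        (fun t ht => (hD t (interior_subset ht)).differentiableAt.differentiableWithinAt) ?_
      intro t ht
      rw [(hD t (interior_subset ht)).deriv]
      rw [interior_Icc] at ht
      have q := hq t (Set.Ioo_subset_Icc_self ht)
      have := hb' t ht
      refine div_nonneg ?_ (by positivity)
      nlinarith [mul_le_mul_of_nonneg_left (neg_abs_le (φ' t)) (pow_pos q 2).le,
        mul_le_mul_of_nonneg_left this q.le]
    have h := mono h0 h1 hT
    simp only [mul_zero, sub_zero, one_pow, div_one] at h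
    rw [le_div_iff₀ (pow_pos (hq T h1) 2)] at h
    linarith
  · have hD : ∀ t ∈ Set.Icc 0 T, HasDerivAt (fun t => (1 - r * t) ^ 2 * φ t)
        (2 * (1 - r * t) * (-r) * φ t + (1 - r * t) ^ 2 * φ' t) t :=
      fun t ht => (hlin t).mul (hd t ht)
    have anti : AntitoneOn (fun t => (1 - r * t) ^ 2 * φ t) (Set.Icc 0 T) := by
      refine antitoneOn_of_deriv_nonpos (convex_Icc 0 T)
        (fun t ht => (hD t ht).continuousAt.continuousWithinAt)
        (fun t ht => (hD t (interior_subset ht)).differentiableAt.differentiableWithinAt) ?_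
      intro t ht
      rw [(hD t (interior_subset ht)).deriv]
      rw [interior_Icc] at ht
      have q := hq t (Set.Ioo_subset_Icc_self ht)
      have := hb' t ht
      nlinarith [mul_le_mul_of_nonneg_left (le_abs_self (φ' t)) (pow_pos q 2).le,
        mul_le_mul_of_nonneg_left this q.le]
    have h := anti h0 h1 hT
    simpa using h

theorem inner_hessOp {E : Type*} [NormedAddCommGroup E] [InnerProductSpace ℝ E]
    [CompleteSpace E] (f : E → ℝ) (z u v : E) :
    ⟪hessOp f z u, v⟫ = fderiv ℝ (fderiv ℝ f) z u v := by
  have h : gradient f = fun z => (InnerProductSpace.toDual ℝ E).symm (fderiv ℝ f z) := rfl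
  have h2 : hessOp f z =
      ((InnerProductSpace.toDual ℝ E).symm.toContinuousLinearEquiv.toContinuousLinearMap).comp
        (fderiv ℝ (fderiv ℝ f) z) := by
    rw [hessOp, h]
    exact (InnerProductSpace.toDual ℝ E).symm.toContinuousLinearEquiv.comp_fderiv
  rw [h2]
  simp

theorem inner_gradient_eq_fderiv {E : Type*} [NormedAddCommGroup E] [InnerProductSpace ℝ E]
    [CompleteSpace E] (f : E → ℝ) (z v : E) : ⟪gradient f z, v⟫ = fderiv ℝ f z v := by
  simp [gradient]

section Calculus

variable {E : Type*} [NormedAddCommGroup E] [NormedSpace ℝ E] {f : E → ℝ} {D : Set E}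

theorem contDiffOn_two_fderiv (hD : IsOpen D) (hf : ContDiffOn ℝ 3 f D) :
    ContDiffOn ℝ 2 (fderiv ℝ f) D :=
  hf.fderiv_of_isOpen hD (by norm_num)

theorem contDiffOn_one_fderiv_fderiv (hD : IsOpen D) (hf : ContDiffOn ℝ 3 f D) :
    ContDiffOn ℝ 1 (fderiv ℝ (fderiv ℝ f)) D :=
  (contDiffOn_two_fderiv hD hf).fderiv_of_isOpen hD (by norm_num)

theorem fderiv_fderiv_symm (hD : IsOpen D) (hf : ContDiffOn ℝ 3 f D) {z : E} (hz : z ∈ D)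
    (u v : E) : fderiv ℝ (fderiv ℝ f) z u v = fderiv ℝ (fderiv ℝ f) z v u :=
  ((hf.contDiffAt (hD.mem_nhds hz)).isSymmSndFDerivAt (by simp; norm_num)).eq u v

theorem fderiv3_symm12 (hD : IsOpen D) (hf : ContDiffOn ℝ 3 f D) {z : E} (hz : z ∈ D)
    (u v w : E) : fderiv ℝ (fderiv ℝ (fderiv ℝ f)) z u v w =
      fderiv ℝ (fderiv ℝ (fderiv ℝ f)) z v u w := by
  rw [(((contDiffOn_two_fderiv hD hf).contDiffAt (hD.mem_nhds hz)).isSymmSndFDerivAt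
    (by simp)).eq u v]

theorem hasFDerivAt_fderiv_fderiv (hD : IsOpen D) (hf : ContDiffOn ℝ 3 f D) {z : E}
    (hz : z ∈ D) : HasFDerivAt (fderiv ℝ (fderiv ℝ f))
      (fderiv ℝ (fderiv ℝ (fderiv ℝ f)) z) z :=
  (((contDiffOn_one_fderiv_fderiv hD hf).contDiffAt (hD.mem_nhds hz)).differentiableAt
    (by norm_num)).hasFDerivAt

theorem fderiv3_symm23 (hD : IsOpen D) (hf : ContDiffOn ℝ 3 f D) {z : E} (hz : z ∈ D)
    (u v w : E) : fderiv ℝ (fderiv ℝ (fderiv ℝ f)) z u v w =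
      fderiv ℝ (fderiv ℝ (fderiv ℝ f)) z u w v := by
  have h := hasFDerivAt_fderiv_fderiv hD hf hz
  have h1 := (h.clm_apply (hasFDerivAt_const v z)).clm_apply (hasFDerivAt_const w z)
  have h2 := (h.clm_apply (hasFDerivAt_const w z)).clm_apply (hasFDerivAt_const v z)
  have h3 := h2.congr_of_eventuallyEq (f₁ := fun y => fderiv ℝ (fderiv ℝ f) y v w) (by
    filter_upwards [hD.mem_nhds hz] with y hy
    exact fderiv_fderiv_symm hD hf hy v w)
  have := congrArg (fun L : E →L[ℝ] ℝ => L u) (h1.unique h3)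
  simpa using this

theorem iteratedFDeriv_three_diag (f : E → ℝ) (z h : E) :
    iteratedFDeriv ℝ 3 f z (fun _ => h) = fderiv ℝ (fderiv ℝ (fderiv ℝ f)) z h h h := by
  rw [iteratedFDeriv_succ_apply_right]
  have : (fun y => fderiv ℝ f y) = fderiv ℝ f := rfl
  rw [this]
  have h2 : (Fin.init fun _ : Fin 3 => h) = fun _ : Fin 2 => h := rfl
  rw [h2, iteratedFDeriv_two_apply]

theorem hasDerivAt_hess_line (hD : IsOpen D) (hf : ContDiffOn ℝ 3 f D) (x d u v : E) {t : ℝ}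
    (hz : x + t • d ∈ D) :
    HasDerivAt (fun s : ℝ => fderiv ℝ (fderiv ℝ f) (x + s • d) u v)
      (fderiv ℝ (fderiv ℝ (fderiv ℝ f)) (x + t • d) d u v) t := by
  have hl : HasDerivAt (fun s : ℝ => x + s • d) d t := by
    simpa using ((hasDerivAt_id t).smul_const d).const_add x
  have := HasFDerivAt.comp_hasDerivAt (E := E →L[ℝ] E →L[ℝ] ℝ) (F := E) t
    (hasFDerivAt_fderiv_fderiv hD hf hz) hl
  have := (this.clm_apply (hasDerivAt_const t u)).clm_apply (hasDerivAt_const t v)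
  simpa using this

theorem hasDerivAt_fderiv_line (hD : IsOpen D) (hf : ContDiffOn ℝ 3 f D) (x d v : E) {t : ℝ}
    (hz : x + t • d ∈ D) :
    HasDerivAt (fun s : ℝ => fderiv ℝ f (x + s • d) v)
      (fderiv ℝ (fderiv ℝ f) (x + t • d) d v) t := by
  have hl : HasDerivAt (fun s : ℝ => x + s • d) d t := by
    simpa using ((hasDerivAt_id t).smul_const d).const_add x
  have h1 := (((contDiffOn_two_fderiv hD hf).contDiffAt (hD.mem_nhds hz)).differentiableAt
    (by norm_num)).hasFDerivAt
  have := h1.comp_hasDerivAt t hl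
  have := this.clm_apply (hasDerivAt_const t v)
  simpa using this

end Calculus

section SelfConcordant

variable {E : Type*} [NormedAddCommGroup E] [InnerProductSpace ℝ E] {f : E → ℝ} {D : Set E}

theorem SelfConcordantOn.abs_fderiv3_le (hf : SelfConcordantOn f D) {z : E} (hz : z ∈ D)
    (hp : ∀ u, u ≠ 0 → 0 < fderiv ℝ (fderiv ℝ f) z u u) (d u : E) :
    |fderiv ℝ (fderiv ℝ (fderiv ℝ f)) z d u u| ≤
      2 * Real.sqrt (fderiv ℝ (fderiv ℝ f) z d d) * fderiv ℝ (fderiv ℝ f) z u u := by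
  obtain ⟨hD, -, hC, hsc⟩ := hf
  refine abs_trilinear_le _ _ 2 (fderiv3_symm12 hD hC hz) (fderiv3_symm23 hD hC hz)
    (fderiv_fderiv_symm hD hC hz) hp (fun h hh => ?_) d u
  have key : ∀ h, fderiv ℝ (fderiv ℝ f) z h h ≤ 1 →
      fderiv ℝ (fderiv ℝ (fderiv ℝ f)) z h h h ≤ 2 := fun h hh => by
    have h0 : 0 ≤ fderiv ℝ (fderiv ℝ f) z h h := by
      by_cases h' : h = 0
      · simp [h']
      · exact (hp h h').le
    have := hsc z hz h
    rw [iteratedFDeriv_three_diag, iteratedFDeriv_two_apply] at this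
    have h1 := Real.rpow_le_one h0 hh (by norm_num : (0 : ℝ) ≤ 3 / 2)
    linarith
  have hneg := key (-h) (by simpa using hh)
  simp only [map_neg, neg_apply, neg_neg] at hneg
  rw [abs_le]
  exact ⟨by linarith, key h hh⟩

theorem SelfConcordantOn.hess_bounds (hf : SelfConcordantOn f D) {x d : E} {r T : ℝ}
    (hT : 0 ≤ T) (hz : ∀ t ∈ Set.Icc 0 T, x + t • d ∈ D)
    (hp : ∀ t ∈ Set.Ico 0 T, ∀ u, u ≠ 0 → 0 < fderiv ℝ (fderiv ℝ f) (x + t • d) u u)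
    (hd : d ≠ 0) (hr : r = Real.sqrt (fderiv ℝ (fderiv ℝ f) x d d)) (hrT : r * T < 1) (u : E) :
    (1 - r * T) ^ 2 * fderiv ℝ (fderiv ℝ f) x u u ≤ fderiv ℝ (fderiv ℝ f) (x + T • d) u u ∧
      (1 - r * T) ^ 2 * fderiv ℝ (fderiv ℝ f) (x + T • d) u u ≤
        fderiv ℝ (fderiv ℝ f) x u u := by
  have r0 : 0 ≤ r := hr ▸ Real.sqrt_nonneg _
  have hder : ∀ u, ∀ t ∈ Set.Icc 0 T,
      HasDerivAt (fun s : ℝ => fderiv ℝ (fderiv ℝ f) (x + s • d) u u)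
        (fderiv ℝ (fderiv ℝ (fderiv ℝ f)) (x + t • d) d u u) t := fun u t ht =>
    hasDerivAt_hess_line hf.1 hf.2.2.1 x d u u (hz t ht)
  have := bounds_of_abs_deriv_le hT r0 (hder u) (fun t ht => ?_) hrT
  · simpa using this
  have ht' : t ∈ Set.Icc 0 T := Set.Ioo_subset_Icc_self ht
  have hsub : ∀ s ∈ Set.Icc 0 t, s ∈ Set.Icc 0 T ∧ s ∈ Set.Ico 0 T := fun s hs =>
    ⟨⟨hs.1, hs.2.trans ht'.2⟩, ⟨hs.1, hs.2.trans_lt ht.2⟩⟩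
  have hb := sqrt_le_of_deriv_le ht'.1 (fun s hs => hder d s (hsub s hs).1)
    (fun s hs => hp s (hsub s hs).2 d hd)
    (fun s hs => (le_abs_self _).trans
      (hf.abs_fderiv3_le (hz s (hsub s hs).1) (hp s (hsub s hs).2) d d))
    (by simpa using hr) (by nlinarith [ht.2] : r * t < 1)
  have htI := hsub t ⟨ht'.1, le_rfl⟩
  refine (hf.abs_fderiv3_le (hz t ht') (hp t htI.2) d u).trans ?_
  have hu0 : 0 ≤ fderiv ℝ (fderiv ℝ f) (x + t • d) u u := by
    by_cases h' : u = 0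
    · simp [h']
    · exact (hp t htI.2 u h').le
  exact mul_le_mul_of_nonneg_right (mul_le_mul_of_nonneg_left hb zero_le_two) hu0

theorem SelfConcordantOn.hess_pos [FiniteDimensional ℝ E] (hf : SelfConcordantOn f D) {x d : E}
    {r : ℝ} (hz : ∀ t ∈ Set.Icc (0 : ℝ) 1, x + t • d ∈ D)
    (hp : ∀ u, u ≠ 0 → 0 < fderiv ℝ (fderiv ℝ f) x u u)
    (hd : d ≠ 0) (hr : r = Real.sqrt (fderiv ℝ (fderiv ℝ f) x d d)) (hr1 : r < 1) :
    ∀ t ∈ Set.Icc (0 : ℝ) 1, ∀ u, u ≠ 0 → 0 < fderiv ℝ (fderiv ℝ f) (x + t • d) u u := by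
  have r0 : 0 ≤ r := hr ▸ Real.sqrt_nonneg _
  have hcont : ContinuousOn (fun p : ℝ × E => fderiv ℝ (fderiv ℝ f) (x + p.1 • d) p.2 p.2)
      (Set.Icc (0 : ℝ) 1 ×ˢ Metric.sphere (0 : E) 1) := by
    have h1 : ContinuousOn (fun p : ℝ × E => fderiv ℝ (fderiv ℝ f) (x + p.1 • d))
        (Set.Icc (0 : ℝ) 1 ×ˢ Metric.sphere (0 : E) 1) :=
      (contDiffOn_one_fderiv_fderiv hf.1 hf.2.2.1).continuousOn.comp (by fun_prop)
        (fun p hp => hz p.1 hp.1)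
    exact (h1.clm_apply continuousOn_snd).clm_apply continuousOn_snd
  have hKc : IsCompact (Set.Icc (0 : ℝ) 1 ×ˢ Metric.sphere (0 : E) 1) :=
    isCompact_Icc.prod (isCompact_sphere 0 1)
  set K := (Set.Icc (0 : ℝ) 1 ×ˢ Metric.sphere (0 : E) 1) ∩
    (fun p : ℝ × E => fderiv ℝ (fderiv ℝ f) (x + p.1 • d) p.2 p.2) ⁻¹' Set.Iic 0 with hK
  have hKcomp : IsCompact K := hKc.of_isClosed_subset
    (hcont.preimage_isClosed_of_isClosed hKc.isClosed isClosed_Iic) Set.inter_subset_left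
  have hmem : ∀ t ∈ Set.Icc (0 : ℝ) 1, ∀ u : E, u ≠ 0 →
      fderiv ℝ (fderiv ℝ f) (x + t • d) u u ≤ 0 → (t, ‖u‖⁻¹ • u) ∈ K := by
    intro t ht u hu h
    refine ⟨⟨ht, by simp [norm_smul, hu]⟩, ?_⟩
    simp only [Set.mem_preimage, Set.mem_Iic, map_smul, smul_apply,
      smul_eq_mul]
    exact mul_nonpos_of_nonneg_of_nonpos (by positivity)
      (mul_nonpos_of_nonneg_of_nonpos (by positivity) h)
  rcases K.eq_empty_or_nonempty with hE | hne
  · intro t ht u hu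
    by_contra hcon
    have := hmem t ht u hu (not_lt.1 hcon)
    rw [hE] at this
    exact this
  · exfalso
    obtain ⟨⟨T, w⟩, ⟨⟨hT, hw⟩, hle⟩, hmin⟩ := hKcomp.exists_isMinOn hne
      (continuous_fst.continuousOn)
    have hw0 : w ≠ 0 := by
      rintro rfl
      simp at hw
    have hpT : ∀ t ∈ Set.Ico 0 T, ∀ u, u ≠ 0 →
        0 < fderiv ℝ (fderiv ℝ f) (x + t • d) u u := by
      intro t ht u hu
      by_contra hcon
      have := hmin (hmem t ⟨ht.1, ht.2.le.trans hT.2⟩ u hu (not_lt.1 hcon))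
      exact absurd ht.2 (not_lt.2 this)
    have hrT : r * T < 1 := by nlinarith [hT.1, hT.2]
    have := (hf.hess_bounds hT.1 (fun t ht => hz t ⟨ht.1, ht.2.trans hT.2⟩) hpT hd hr hrT w).1
    have h2 : 0 < (1 - r * T) ^ 2 * fderiv ℝ (fderiv ℝ f) x w w :=
      mul_pos (pow_pos (by linarith) 2) (hp w hw0)
    exact absurd (h2.trans_le this) (not_lt.2 hle)

theorem SelfConcordantOn.gradient_bound [FiniteDimensional ℝ E] (hf : SelfConcordantOn f D)
    {x d : E} {r : ℝ} (hz : ∀ t ∈ Set.Icc (0 : ℝ) 1, x + t • d ∈ D)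
    (hp : ∀ u, u ≠ 0 → 0 < fderiv ℝ (fderiv ℝ f) x u u)
    (hd : d ≠ 0) (hr : r = Real.sqrt (fderiv ℝ (fderiv ℝ f) x d d)) (hr1 : r < 1) (v : E) :
    fderiv ℝ f (x + d) v - fderiv ℝ f x v - fderiv ℝ (fderiv ℝ f) x d v ≤
      r ^ 2 / (1 - r) * Real.sqrt (fderiv ℝ (fderiv ℝ f) x v v) := by
  have r0 : 0 ≤ r := hr ▸ Real.sqrt_nonneg _
  have hpos := hf.hess_pos hz hp hd hr hr1
  have hD := hf.1
  have hC := hf.2.2.1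
  have hx : x ∈ D := by simpa using hz 0 ⟨le_rfl, zero_le_one⟩
  set V := Real.sqrt (fderiv ℝ (fderiv ℝ f) x v v)
  have hq : ∀ t ∈ Set.Icc (0 : ℝ) 1, 0 < 1 - r * t := fun t ht => by nlinarith [ht.1, ht.2]
  have hbd : ∀ t ∈ Set.Icc (0 : ℝ) 1,
      fderiv ℝ (fderiv ℝ f) (x + t • d) d v - fderiv ℝ (fderiv ℝ f) x d v ≤
        (1 / (1 - r * t) ^ 2 - 1) * r * V := by
    intro t ht
    have q := hq t ht
    have q2 : 0 < (1 - r * t) ^ 2 := pow_pos q 2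
    have := abs_bilinear_le
      (fderiv ℝ (fderiv ℝ f) (x + t • d) - fderiv ℝ (fderiv ℝ f) x)
      (fderiv ℝ (fderiv ℝ f) x) (1 / (1 - r * t) ^ 2 - 1)
      (fun u v => by
        simp only [sub_apply]
        rw [fderiv_fderiv_symm hD hC (hz t ht), fderiv_fderiv_symm hD hC hx])
      (fderiv_fderiv_symm hD hC hx) hp
      (fun u => by
        obtain ⟨lo, hi⟩ := hf.hess_bounds ht.1
          (fun s hs => hz s ⟨hs.1, hs.2.trans ht.2⟩)
          (fun s hs => hpos s ⟨hs.1, hs.2.le.trans ht.2⟩) hd hr (by linarith) u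
        have hu0 : 0 ≤ fderiv ℝ (fderiv ℝ f) x u u := by
          by_cases h' : u = 0
          · simp [h']
          · exact (hp u h').le
        have hi' : fderiv ℝ (fderiv ℝ f) (x + t • d) u u ≤
            1 / (1 - r * t) ^ 2 * fderiv ℝ (fderiv ℝ f) x u u := by
          rw [one_div_mul_eq_div, le_div_iff₀ q2]; linarith
        have hk : 1 - (1 - r * t) ^ 2 ≤ 1 / (1 - r * t) ^ 2 - 1 := by
          have : 1 / (1 - r * t) ^ 2 - 1 - (1 - (1 - r * t) ^ 2) =
              (1 - (1 - r * t) ^ 2) ^ 2 / (1 - r * t) ^ 2 := by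
            field_simp
          have h2 : 0 ≤ (1 - (1 - r * t) ^ 2) ^ 2 / (1 - r * t) ^ 2 := by positivity
          linarith
        simp only [sub_apply]
        rw [abs_le]
        constructor
        · nlinarith [mul_le_mul_of_nonneg_right hk hu0]
        · linarith) d v
    rw [← hr] at this
    exact (le_abs_self _).trans this
  have hden : ∀ t ∈ Set.Icc (0 : ℝ) 1, HasDerivAt (fun s : ℝ => ((1 - r * s)⁻¹ - 1 - r * s) * V)
      ((1 / (1 - r * t) ^ 2 - 1) * r * V) t := by
    intro t ht
    have hl : HasDerivAt (fun s : ℝ => r * s) r t := by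
      simpa using (hasDerivAt_id t).const_mul r
    exact (((((hl.const_sub 1).fun_inv (hq t ht).ne').sub_const 1).sub hl).mul_const V).congr_deriv
      (by ring)
  have hg : ∀ t ∈ Set.Icc (0 : ℝ) 1, HasDerivAt (fun s : ℝ => fderiv ℝ f (x + s • d) v
        - s * fderiv ℝ (fderiv ℝ f) x d v - ((1 - r * s)⁻¹ - 1 - r * s) * V)
      (fderiv ℝ (fderiv ℝ f) (x + t • d) d v - fderiv ℝ (fderiv ℝ f) x d v
        - (1 / (1 - r * t) ^ 2 - 1) * r * V) t := by
    intro t ht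
    have hl : HasDerivAt (fun s : ℝ => s * fderiv ℝ (fderiv ℝ f) x d v)
        (fderiv ℝ (fderiv ℝ f) x d v) t := by
      simpa using (hasDerivAt_id t).mul_const (fderiv ℝ (fderiv ℝ f) x d v)
    exact ((hasDerivAt_fderiv_line hD hC x d v (hz t ht)).sub hl).sub (hden t ht)
  have anti := antitoneOn_of_deriv_nonpos (convex_Icc (0 : ℝ) 1)
    (fun t ht => (hg t ht).continuousAt.continuousWithinAt)
    (fun t ht => (hg t (interior_subset ht)).differentiableAt.differentiableWithinAt)
    (fun t ht => by
      rw [(hg t (interior_subset ht)).deriv]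
      linarith [hbd t (interior_subset ht)])
  have h := anti (⟨le_rfl, zero_le_one⟩ : (0 : ℝ) ∈ Set.Icc (0 : ℝ) 1)
    (⟨zero_le_one, le_rfl⟩ : (1 : ℝ) ∈ Set.Icc (0 : ℝ) 1) zero_le_one
  simp only [one_smul, zero_smul, add_zero, mul_one, mul_zero, sub_zero, one_mul, zero_mul,
    inv_one, sub_self] at h
  have e : r ^ 2 / (1 - r) = (1 - r)⁻¹ - 1 - r := by
    have : 1 - r ≠ 0 := by linarith
    field_simp; ring
  rw [e]
  linarith

end SelfConcordant

/-- Lemma 2.1 of the paper. If `f` is self-concordant on `D`, `x ∈ D` has a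
positive definite Hessian, and `y ∈ D` satisfies `r = ‖y - x‖ₓ < 1`, then
`‖∇f(y) - ∇f(x) - ∇²f(x)(y-x)‖ₓ^* ≤ r²/(1-r)`, the dual local norm being computed with the
inverse `Hinv` of the Hessian at `x`. -/
theorem stmt0 {E : Type*} [NormedAddCommGroup E] [InnerProductSpace ℝ E]
    [FiniteDimensional ℝ E]
    (f : E → ℝ) (D : Set E) (hf : SelfConcordantOn f D)
    (x : E) (hx : x ∈ D)
    (hpos : ∀ u : E, u ≠ 0 → 0 < ⟪hessOp f x u, u⟫)
    (y : E) (hy : y ∈ D)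
    (r : ℝ) (hr : r = Real.sqrt ⟪hessOp f x (y - x), y - x⟫) (hr1 : r < 1)
    (Hinv : E →ₗ[ℝ] E)
    (hHinv : ∀ u : E, Hinv (hessOp f x u) = u ∧ hessOp f x (Hinv u) = u) :
    Real.sqrt ⟪gradient f y - gradient f x - hessOp f x (y - x),
        Hinv (gradient f y - gradient f x - hessOp f x (y - x))⟫
      ≤ r ^ 2 / (1 - r) := by
  have hHp : ∀ u : E, u ≠ 0 → 0 < fderiv ℝ (fderiv ℝ f) x u u := fun u hu => by
    rw [← inner_hessOp]; exact hpos u hu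
  have r0 : 0 ≤ r := hr ▸ Real.sqrt_nonneg _
  have hrhs : 0 ≤ r ^ 2 / (1 - r) := div_nonneg (sq_nonneg r) (by linarith)
  by_cases hd : y - x = 0
  · have hyx : y = x := sub_eq_zero.1 hd
    subst hyx
    simpa using hrhs
  have hz : ∀ t ∈ Set.Icc (0 : ℝ) 1, x + t • (y - x) ∈ D := fun t ht =>
    hf.2.1.add_smul_sub_mem hx hy ht
  rw [inner_hessOp] at hr
  set G := gradient f y - gradient f x - hessOp f x (y - x) with hG
  have h := hf.gradient_bound hz hHp hd hr hr1 (Hinv G)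
  rw [add_sub_cancel, ← inner_hessOp, ← inner_hessOp, ← inner_gradient_eq_fderiv, ← inner_gradient_eq_fderiv,
    ← inner_sub_left, ← inner_sub_left, ← hG, (hHinv G).2] at h
  by_cases hN : ⟪G, Hinv G⟫ ≤ 0
  · rw [Real.sqrt_eq_zero_of_nonpos hN]; exact hrhs
  · rw [not_le] at hN
    have s := Real.sqrt_pos.2 hN
    refine le_of_mul_le_mul_right ?_ s
    rwa [Real.mul_self_sqrt hN.le]
end

section
/- Let ψ be self-concordant on an open convex set D ⊆ E with ∇²ψ(y) positive definite for every y ∈ D, and suppose ψ(yᵢ) → +∞ along every sequence of points of D converging to a boundary point of D. Let ȳ ∈ D, let d̄ := [∇²ψ(ȳ)]⁻¹∇ψ(ȳ) and λ̄ := ⟨∇ψ(ȳ), d̄⟩^{1/2}, and assume λ̄ ≤ β for some β ∈ (0,1). Then the backward Newton step ŷ := ȳ + d̄ belongs to D and ‖∇ψ(ŷ)‖_ŷ^* ≤ (2β − β²)/(1 − β)². -/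
open scoped RealInnerProductSpace

lemma abs_binaryCubic_polarization_le {A B C D K : ℝ}
    (hK : ∀ x y : ℝ, x ^ 2 + y ^ 2 = 1 →
      |A * x ^ 3 + 3 * B * x ^ 2 * y + 3 * C * x * y ^ 2 + D * y ^ 3| ≤ K)
    {x y : ℝ} (hxy : x ^ 2 + y ^ 2 = 1) : |A * x + B * y| ≤ K := by
  obtain ⟨φ, hx, hy⟩ : ∃ φ : ℝ, x = Real.cos (3 * φ) ∧ y = Real.sin (3 * φ) := by
    obtain ⟨α, hα⟩ : ∃ α : ℝ, (⟨x, y⟩ : ℂ) = Complex.exp (α * Complex.I) := by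
      refine ⟨Complex.arg ⟨x, y⟩, ?_⟩
      have h1 : ‖(⟨x, y⟩ : ℂ)‖ = 1 := by
        rw [Complex.norm_def, Complex.normSq_mk, ← sq, ← sq, hxy, Real.sqrt_one]
      have h2 := Complex.norm_mul_exp_arg_mul_I ⟨x, y⟩
      rw [h1, Complex.ofReal_one, one_mul] at h2
      exact h2.symm
    refine ⟨α / 3, ?_, ?_⟩
    · have := congrArg Complex.re hα
      rw [Complex.exp_ofReal_mul_I_re] at this
      rw [mul_div_cancel₀ _ (three_ne_zero), ← this]
    · have := congrArg Complex.im hα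
      rw [Complex.exp_ofReal_mul_I_im] at this
      rw [mul_div_cancel₀ _ (three_ne_zero), ← this]
  rw [Real.cos_three_mul] at hx
  rw [Real.sin_three_mul] at hy
  obtain ⟨r, hr⟩ : ∃ r : ℝ, r ^ 2 = 3 := ⟨√3, Real.sq_sqrt (by norm_num)⟩
  have hsc := Real.sin_sq_add_cos_sq φ
  generalize Real.sin φ = s at *
  generalize Real.cos φ = c at *
  have h0 := hK c s (by linarith)
  have h1 := hK (c / 2 - r * s / 2) (s / 2 + r * c / 2) (by grind)
  have h2 := hK (-c / 2 - r * s / 2) (-s / 2 + r * c / 2) (by grind)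
  set s1 := s / 2 + r * c / 2 with hs1
  set s2 := -s / 2 + r * c / 2 with hs2
  set c1 := c / 2 - r * s / 2 with hc1
  set c2 := -c / 2 - r * s / 2 with hc2
  have hsum : 16 / 9 * (s1 * s2) ^ 2 + 16 / 9 * (s * s2) ^ 2 + 16 / 9 * (s * s1) ^ 2 = 1 := by
    grind
  have key : A * x + B * y =
      16 / 9 * (s1 * s2) ^ 2 * (A * c ^ 3 + 3 * B * c ^ 2 * s + 3 * C * c * s ^ 2 + D * s ^ 3)
      - 16 / 9 * (s * s2) ^ 2 *
        (A * c1 ^ 3 + 3 * B * c1 ^ 2 * s1 + 3 * C * c1 * s1 ^ 2 + D * s1 ^ 3)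
      + 16 / 9 * (s * s1) ^ 2 *
        (A * c2 ^ 3 + 3 * B * c2 ^ 2 * s2 + 3 * C * c2 * s2 ^ 2 + D * s2 ^ 3) := by
    have eA : x = 16 / 9 * (s1 * s2) ^ 2 * c ^ 3 - 16 / 9 * (s * s2) ^ 2 * c1 ^ 3
        + 16 / 9 * (s * s1) ^ 2 * c2 ^ 3 := by grind
    have eB : y = 3 * (16 / 9 * (s1 * s2) ^ 2 * (c ^ 2 * s) - 16 / 9 * (s * s2) ^ 2 * (c1 ^ 2 * s1)
        + 16 / 9 * (s * s1) ^ 2 * (c2 ^ 2 * s2)) := by grind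
    rw [eA, eB]
    have hc : c - c1 + c2 = 0 := by ring
    have hs : s - s1 + s2 = 0 := by ring
    linear_combination (-(16 / 3) * C * s ^ 2 * s1 ^ 2 * s2 ^ 2) * hc
      - (16 / 9 * D * s ^ 2 * s1 ^ 2 * s2 ^ 2) * hs
  rw [abs_le] at *
  have p0 : 0 ≤ 16 / 9 * (s1 * s2) ^ 2 := by positivity
  have p1 : 0 ≤ 16 / 9 * (s * s2) ^ 2 := by positivity
  have p2 : 0 ≤ 16 / 9 * (s * s1) ^ 2 := by positivity
  have hKs : K = 16 / 9 * (s1 * s2) ^ 2 * K + 16 / 9 * (s * s2) ^ 2 * K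
    + 16 / 9 * (s * s1) ^ 2 * K := by rw [← add_mul, ← add_mul, hsum, one_mul]
  constructor
  · linarith [mul_le_mul_of_nonneg_left h0.1 p0, mul_le_mul_of_nonneg_left h1.2 p1,
      mul_le_mul_of_nonneg_left h2.1 p2]
  · linarith [mul_le_mul_of_nonneg_left h0.2 p0, mul_le_mul_of_nonneg_left h1.1 p1,
      mul_le_mul_of_nonneg_left h2.2 p2]

section
variable {V : Type*} [NormedAddCommGroup V] [NormedSpace ℝ V]

lemma apply_le_sqrt_mul_sqrt {Q : V →L[ℝ] V →L[ℝ] ℝ} (hQs : ∀ u v, Q u v = Q v u)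
    (hQ : ∀ u, 0 ≤ Q u u) (u v : V) : |Q u v| ≤ √(Q u u) * √(Q v v) := by
  rw [← Real.sqrt_mul (hQ u)]
  apply Real.abs_le_sqrt
  have h := LinearMap.BilinForm.apply_mul_apply_le_of_forall_zero_le
    (LinearMap.mk₂ ℝ (fun a b => Q a b) (by simp) (by simp) (by simp) (by simp)) hQ u v
  simpa [sq, hQs v u] using h

lemma abs_trilinear_le_of_unit {Q : V →L[ℝ] V →L[ℝ] ℝ} {T : V →L[ℝ] V →L[ℝ] V →L[ℝ] ℝ}
    (hQs : ∀ u v, Q u v = Q v u) (hQ : ∀ u, u ≠ 0 → 0 < Q u u)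
    (hT1 : ∀ u v w, T u v w = T v u w) (hT2 : ∀ u v w, T u v w = T u w v)
    {K : ℝ} (hK : ∀ u, Q u u = 1 → |T u u u| ≤ K)
    {u h : V} (hu : Q u u = 1) (hh : Q h h = 1) : |T h u u| ≤ K := by
  set x := Q u h with hx
  have hxu : Q h u = x := hQs _ _
  by_cases hw : h - x • u = 0
  · have h1 : h = x • u := sub_eq_zero.1 hw
    have hx2 : x ^ 2 = 1 := by
      have := hh
      rw [h1] at this
      simp only [map_smul, smul_apply, smul_eq_mul, hu] at this
      linarith
    have hx1 : |x| = 1 := by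
      rw [← sq_abs] at hx2
      nlinarith [abs_nonneg x]
    rw [h1, map_smul, smul_apply, smul_apply,
      smul_eq_mul, abs_mul, hx1, one_mul]
    exact hK u hu
  · have hpos := hQ _ hw
    set y := √(Q (h - x • u) (h - x • u)) with hy
    have hy0 : 0 < y := Real.sqrt_pos.2 hpos
    have hy2 : x ^ 2 + y ^ 2 = 1 := by
      rw [hy, Real.sq_sqrt hpos.le]
      simp only [map_sub, map_smul, smul_apply, smul_eq_mul, hu,
        sub_apply, hh, ← hx, hxu]
      ring
    set v := y⁻¹ • (h - x • u) with hv
    have hhv : h = x • u + y • v := by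
      rw [hv, smul_smul, mul_inv_cancel₀ hy0.ne', one_smul]; abel
    have huv : Q u v = 0 := by
      rw [hv]; simp [hu, ← hx]
    have hvu : Q v u = 0 := by rw [hQs, huv]
    have hvv : Q v v = 1 := by
      have := hh
      rw [hhv] at this
      simp only [map_add, map_smul, smul_apply, smul_eq_mul, hu,
        add_apply, huv, hvu] at this
      have h3 : y ^ 2 * (Q v v - 1) = 0 := by linarith
      rcases mul_eq_zero.1 h3 with h4 | h4
      · exact absurd h4 (by positivity)
      · linarith
    have key := abs_binaryCubic_polarization_le (A := T u u u) (B := T u u v) (C := T u v v)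
      (D := T v v v) (K := K) (fun a b hab => by
        have h5 := hK (a • u + b • v) (by
          simp only [map_add, map_smul, smul_apply, smul_eq_mul, hu,
            add_apply, huv, hvu, hvv]
          linarith)
        simp only [map_add, map_smul, smul_apply, smul_eq_mul,
          add_apply] at h5
        rw [hT1 v u u, hT1 v u v, hT2 u v u, hT2 v v u, hT1 v u v] at h5
        convert h5 using 2
        ring) hy2
    convert key using 2
    nth_rw 1 [hhv]
    simp only [map_add, map_smul, smul_apply, smul_eq_mul,
          add_apply]
    rw [hT1 v u u, hT2 u v u]; ring

lemma abs_trilinear_le_s1 {Q : V →L[ℝ] V →L[ℝ] ℝ} {T : V →L[ℝ] V →L[ℝ] V →L[ℝ] ℝ}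
    (hQs : ∀ u v, Q u v = Q v u) (hQ : ∀ u, u ≠ 0 → 0 < Q u u)
    (hT1 : ∀ u v w, T u v w = T v u w) (hT2 : ∀ u v w, T u v w = T u w v)
    {K : ℝ} (hK : ∀ u, T u u u ≤ K * (Q u u) ^ ((3 : ℝ) / 2)) (u h : V) :
    |T h u u| ≤ K * √(Q h h) * Q u u := by
  by_cases hu : u = 0
  · simp [hu]
  by_cases hh : h = 0
  · simp [hh]
  have hunit : ∀ w, Q w w = 1 → |T w w w| ≤ K := fun w hw => by
    have h1 := hK w
    have h2 := hK (-w)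
    simp only [map_neg, neg_apply, neg_neg, hw, Real.one_rpow, mul_one]
      at h1 h2
    exact abs_le.2 ⟨by linarith, h1⟩
  have hnorm : ∀ w, w ≠ 0 → Q ((√(Q w w))⁻¹ • w) ((√(Q w w))⁻¹ • w) = 1 := fun w hw => by
    have h1 := hQ w hw
    have h2 := Real.sqrt_pos.2 h1
    simp only [map_smul, smul_apply, smul_eq_mul]
    nth_rw 3 [← Real.mul_self_sqrt h1.le]
    field_simp
  have h3 := abs_trilinear_le_of_unit hQs hQ hT1 hT2 hunit (hnorm u hu) (hnorm h hh)
  have hu0 := Real.sqrt_pos.2 (hQ u hu)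
  have hh0 := Real.sqrt_pos.2 (hQ h hh)
  simp only [map_smul, smul_apply, smul_eq_mul, abs_mul, abs_inv,
    abs_of_pos hu0, abs_of_pos hh0] at h3
  have hm := Real.mul_self_sqrt (hQ u hu).le
  generalize √(Q u u) = m at *
  rw [← hm]
  field_simp at h3
  linarith
end

lemma sqrt_le_of_abs_deriv_le {a a' : ℝ → ℝ} {s l : ℝ} (hs : 0 ≤ s) (hl : √(a 0) ≤ l)
    (hls : l * s < 1)
    (ha : ∀ t ∈ Set.Icc 0 s, 0 < a t) (hd : ∀ t ∈ Set.Icc 0 s, HasDerivAt a (a' t) t)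
    (hb : ∀ t ∈ Set.Icc 0 s, |a' t| ≤ 2 * √(a t) * a t) :
    ∀ t ∈ Set.Icc 0 s, √(a t) ≤ l / (1 - l * t) := by
  intro t ht
  have hder : ∀ x ∈ Set.Icc 0 s, HasDerivAt (fun x => (√(a x))⁻¹ + x)
      (-(a' x / (2 * √(a x))) / (√(a x)) ^ 2 + 1) x := fun x hx =>
    (((hd x hx).sqrt (ha x hx).ne').inv (Real.sqrt_pos.2 (ha x hx)).ne').add (hasDerivAt_id x)
  have hmono := monotoneOn_of_hasDerivWithinAt_nonneg (convex_Icc 0 s)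
    (fun x hx => (hder x hx).continuousAt.continuousWithinAt)
    (fun x hx => (hder x (interior_subset hx)).hasDerivWithinAt)
    (fun x hx => by
      have hx := interior_subset hx
      have h0 := Real.sqrt_pos.2 (ha x hx)
      have h1 := (abs_le.1 (hb x hx)).2
      have h2 := Real.sq_sqrt (ha x hx).le
      rw [neg_div, div_div, neg_add_eq_sub, sub_nonneg, div_le_one (by positivity), h2]
      exact h1)
  have h1 := hmono (Set.left_mem_Icc.2 hs) ht ht.1
  have h00 := Real.sqrt_pos.2 (ha 0 (Set.left_mem_Icc.2 hs))
  have h0 := Real.sqrt_pos.2 (ha t ht)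
  simp only [add_zero] at h1
  have hl0 : 0 < l := h00.trans_le hl
  have h2 : l⁻¹ ≤ (√(a 0))⁻¹ := inv_anti₀ h00 hl
  have h3 : l * t < 1 := (mul_le_mul_of_nonneg_left ht.2 hl0.le).trans_lt hls
  have h4 : l⁻¹ - t ≤ (√(a t))⁻¹ := by linarith
  have h5 : l⁻¹ - t = (1 - l * t) / l := by field_simp
  rw [h5] at h4
  have h6 := inv_anti₀ (div_pos (by linarith) hl0) h4
  rwa [inv_inv, inv_div] at h6

lemma mul_sq_le_and_mul_sq_le_of_abs_deriv_le {b b' : ℝ → ℝ} {s l : ℝ} (hs : 0 ≤ s) (hl0 : 0 ≤ l)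
    (hls : l * s < 1)
    (hd : ∀ t ∈ Set.Icc 0 s, HasDerivAt b (b' t) t)
    (hb : ∀ t ∈ Set.Icc 0 s, |b' t| ≤ 2 * (l / (1 - l * t)) * b t) :
    ∀ t ∈ Set.Icc 0 s, b t * (1 - l * t) ^ 2 ≤ b 0 ∧ b 0 * (1 - l * t) ^ 2 ≤ b t := by
  intro t ht
  have hlt : ∀ x ∈ Set.Icc 0 s, 0 < 1 - l * x := fun x hx => by
    linarith [mul_le_mul_of_nonneg_left hx.2 hl0]
  have hlin : ∀ x, HasDerivAt (fun x => (1 - l * x) ^ 2) (2 * (1 - l * x) * -l) x := fun x => by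
    have := (((hasDerivAt_id x).const_mul l).const_sub 1).fun_pow 2
    simpa using this
  have hder1 : ∀ x ∈ Set.Icc 0 s, HasDerivAt (fun x => b x * (1 - l * x) ^ 2)
      (b' x * (1 - l * x) ^ 2 + b x * (2 * (1 - l * x) * -l)) x := fun x hx =>
    (hd x hx).mul (hlin x)
  have hder2 : ∀ x ∈ Set.Icc 0 s, HasDerivAt (fun x => b x / (1 - l * x) ^ 2)
      ((b' x * (1 - l * x) ^ 2 - b x * (2 * (1 - l * x) * -l)) / ((1 - l * x) ^ 2) ^ 2) x :=
    fun x hx => (hd x hx).div (hlin x) (pow_pos (hlt x hx) 2).ne'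
  have hbd : ∀ x ∈ Set.Icc 0 s, |b' x * (1 - l * x) ^ 2| ≤ b x * (2 * (1 - l * x) * l) := by
    intro x hx
    have h0 := hlt x hx
    rw [abs_mul, abs_of_pos (pow_pos h0 2)]
    calc _ ≤ (2 * (l / (1 - l * x)) * b x) * (1 - l * x) ^ 2 := by gcongr; exact hb x hx
      _ = _ := by field_simp
  have h1 := antitoneOn_of_hasDerivWithinAt_nonpos (convex_Icc 0 s)
    (fun x hx => (hder1 x hx).continuousAt.continuousWithinAt)
    (fun x hx => (hder1 x (interior_subset hx)).hasDerivWithinAt)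
    (fun x hx => by linarith [(abs_le.1 (hbd x (interior_subset hx))).2])
    (Set.left_mem_Icc.2 hs) ht ht.1
  have h2 := monotoneOn_of_hasDerivWithinAt_nonneg (convex_Icc 0 s)
    (fun x hx => (hder2 x hx).continuousAt.continuousWithinAt)
    (fun x hx => (hder2 x (interior_subset hx)).hasDerivWithinAt)
    (fun x hx => div_nonneg (by linarith [(abs_le.1 (hbd x (interior_subset hx))).1])
      (by positivity))
    (Set.left_mem_Icc.2 hs) ht ht.1
  simp only [mul_zero, sub_zero, one_pow, mul_one, div_one] at h1 h2
  exact ⟨h1, (le_div_iff₀ (pow_pos (hlt t ht) 2)).1 h2⟩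

section
variable {E : Type*} [NormedAddCommGroup E] [InnerProductSpace ℝ E]

lemma inner_hessOp_apply [CompleteSpace E] {f : E → ℝ} {x : E}
    (hf : DifferentiableAt ℝ (fderiv ℝ f) x) (u v : E) :
    ⟪hessOp f x u, v⟫ = fderiv ℝ (fderiv ℝ f) x u v := by
  let L : StrongDual ℝ E →L[ℝ] E :=
    ⟨⟨⟨(InnerProductSpace.toDual ℝ E).symm, map_add _⟩, fun c z => by simp⟩,
      (InnerProductSpace.toDual ℝ E).symm.continuous⟩
  have h : gradient f = L ∘ fderiv ℝ f := rfl
  rw [hessOp, h, (L.hasFDerivAt.comp x hf.hasFDerivAt).fderiv]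
  exact InnerProductSpace.toDual_symm_apply

lemma inner_gradient_apply [CompleteSpace E] (f : E → ℝ) (x u : E) :
    ⟪gradient f x, u⟫ = fderiv ℝ f x u :=
  InnerProductSpace.toDual_symm_apply

namespace SelfConcordantOn

variable {f : E → ℝ} {D : Set E}

lemma contDiffAt (hf : SelfConcordantOn f D) {x : E} (hx : x ∈ D) : ContDiffAt ℝ 3 f x :=
  hf.2.2.1.contDiffAt (hf.1.mem_nhds hx)

lemma contDiffAt_fderiv (hf : SelfConcordantOn f D) {x : E} (hx : x ∈ D) :
    ContDiffAt ℝ 2 (fderiv ℝ f) x :=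
  (hf.contDiffAt hx).fderiv_right (by norm_num)

lemma contDiffAt_fderiv_fderiv (hf : SelfConcordantOn f D) {x : E} (hx : x ∈ D) :
    ContDiffAt ℝ 1 (fderiv ℝ (fderiv ℝ f)) x :=
  (hf.contDiffAt_fderiv hx).fderiv_right (by norm_num)

lemma differentiableAt_fderiv (hf : SelfConcordantOn f D) {x : E} (hx : x ∈ D) :
    DifferentiableAt ℝ (fderiv ℝ f) x :=
  (hf.contDiffAt_fderiv hx).differentiableAt (by norm_num)

lemma differentiableAt_fderiv_fderiv (hf : SelfConcordantOn f D) {x : E} (hx : x ∈ D) :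
    DifferentiableAt ℝ (fderiv ℝ (fderiv ℝ f)) x :=
  (hf.contDiffAt_fderiv_fderiv hx).differentiableAt (by norm_num)

lemma fderiv_fderiv_symm (hf : SelfConcordantOn f D) {x : E} (hx : x ∈ D) (u v : E) :
    fderiv ℝ (fderiv ℝ f) x u v = fderiv ℝ (fderiv ℝ f) x v u :=
  (hf.contDiffAt hx).isSymmSndFDerivAt
    (by rw [minSmoothness_of_isRCLikeNormedField]; norm_num) u v

lemma abs_third_fderiv_le (hf : SelfConcordantOn f D)
    (hpos : ∀ y ∈ D, ∀ u : E, u ≠ 0 → 0 < fderiv ℝ (fderiv ℝ f) y u u)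
    {x : E} (hx : x ∈ D) (u h : E) :
    |fderiv ℝ (fderiv ℝ (fderiv ℝ f)) x h u u| ≤
      2 * √(fderiv ℝ (fderiv ℝ f) x h h) * fderiv ℝ (fderiv ℝ f) x u u := by
  refine abs_trilinear_le_s1 (hf.fderiv_fderiv_symm hx) (hpos x hx) ?_ ?_ ?_ u h
  · intro u v w
    rw [(hf.contDiffAt_fderiv hx).isSymmSndFDerivAt (by simp) u v]
  · intro u v w
    have hd := (hf.differentiableAt_fderiv_fderiv hx).hasFDerivAt
    have h1 : HasFDerivAt (fun y => fderiv ℝ (fderiv ℝ f) y v w) _ x :=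
      (hd.clm_apply (hasFDerivAt_const v x)).clm_apply (hasFDerivAt_const w x)
    have h2 : HasFDerivAt (fun y => fderiv ℝ (fderiv ℝ f) y w v) _ x :=
      (hd.clm_apply (hasFDerivAt_const w x)).clm_apply (hasFDerivAt_const v x)
    have h3 : (fun y => fderiv ℝ (fderiv ℝ f) y v w) =ᶠ[nhds x]
        fun y => fderiv ℝ (fderiv ℝ f) y w v := by
      filter_upwards [hf.1.mem_nhds hx] with y hy using hf.fderiv_fderiv_symm hy v w
    simpa using DFunLike.congr_fun ((h1.congr_of_eventuallyEq h3.symm).unique h2) u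
  · intro u
    have h := hf.2.2.2 x hx u
    rwa [iteratedFDeriv_two_apply, iteratedFDeriv_succ_apply_right,
      iteratedFDeriv_two_apply] at h

section Line

variable {y d : E} {s l : ℝ}

lemma hasDerivAt_comp_line {F : Type*} [NormedAddCommGroup F] [NormedSpace ℝ F] {g : E → F}
    {t : ℝ} (hg : DifferentiableAt ℝ g (y + t • d)) :
    HasDerivAt (fun t : ℝ => g (y + t • d)) (fderiv ℝ g (y + t • d) d) t := by
  have h : HasDerivAt (fun t : ℝ => y + t • d) d t := by
    simpa using ((hasDerivAt_id t).smul_const d).const_add y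
  exact hg.hasFDerivAt.comp_hasDerivAt t h

lemma hasDerivAt_fderiv_fderiv_line (hf : SelfConcordantOn f D) {t : ℝ} (ht : y + t • d ∈ D)
    (u v : E) :
    HasDerivAt (fun t : ℝ => fderiv ℝ (fderiv ℝ f) (y + t • d) u v)
      (fderiv ℝ (fderiv ℝ (fderiv ℝ f)) (y + t • d) d u v) t := by
  have h := hasDerivAt_comp_line (F := E →L[ℝ] E →L[ℝ] ℝ) (hf.differentiableAt_fderiv_fderiv ht)
  have hu := (ContinuousLinearMap.apply ℝ (E →L[ℝ] ℝ) u).hasFDerivAt.comp_hasDerivAt t h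
  exact (ContinuousLinearMap.apply ℝ ℝ v).hasFDerivAt.comp_hasDerivAt t hu

lemma hasDerivAt_fderiv_line (hf : SelfConcordantOn f D) {t : ℝ} (ht : y + t • d ∈ D) (u : E) :
    HasDerivAt (fun t : ℝ => fderiv ℝ f (y + t • d) u)
      (fderiv ℝ (fderiv ℝ f) (y + t • d) d u) t := by
  exact (ContinuousLinearMap.apply ℝ ℝ u).hasFDerivAt.comp_hasDerivAt t
    (hasDerivAt_comp_line (hf.differentiableAt_fderiv ht))

lemma sqrt_fderiv_fderiv_line_le (hf : SelfConcordantOn f D)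
    (hpos : ∀ y ∈ D, ∀ u : E, u ≠ 0 → 0 < fderiv ℝ (fderiv ℝ f) y u u)
    (hs : 0 ≤ s) (hl0 : 0 ≤ l) (hls : l * s < 1) (hD : ∀ t ∈ Set.Icc 0 s, y + t • d ∈ D)
    (hl : √(fderiv ℝ (fderiv ℝ f) y d d) ≤ l) :
    ∀ t ∈ Set.Icc 0 s, √(fderiv ℝ (fderiv ℝ f) (y + t • d) d d) ≤ l / (1 - l * t) := by
  by_cases hd : d = 0
  · intro t ht
    have := mul_le_mul_of_nonneg_left ht.2 hl0
    simp only [hd, map_zero, Real.sqrt_zero]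
    exact div_nonneg hl0 (by linarith)
  · exact sqrt_le_of_abs_deriv_le hs (by simpa using hl) hls (fun t ht => hpos _ (hD t ht) d hd)
      (fun t ht => hf.hasDerivAt_fderiv_fderiv_line (hD t ht) d d)
      (fun t ht => hf.abs_third_fderiv_le hpos (hD t ht) d d)

lemma fderiv_fderiv_nonneg
    (hpos : ∀ y ∈ D, ∀ u : E, u ≠ 0 → 0 < fderiv ℝ (fderiv ℝ f) y u u) {x : E} (hx : x ∈ D)
    (u : E) : 0 ≤ fderiv ℝ (fderiv ℝ f) x u u := by
  by_cases hu : u = 0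
  · simp [hu]
  · exact (hpos x hx u hu).le

lemma fderiv_fderiv_line_le_and_le (hf : SelfConcordantOn f D)
    (hpos : ∀ y ∈ D, ∀ u : E, u ≠ 0 → 0 < fderiv ℝ (fderiv ℝ f) y u u)
    (hs : 0 ≤ s) (hl0 : 0 ≤ l) (hls : l * s < 1) (hD : ∀ t ∈ Set.Icc 0 s, y + t • d ∈ D)
    (hl : √(fderiv ℝ (fderiv ℝ f) y d d) ≤ l) (u : E) :
    ∀ t ∈ Set.Icc 0 s,
      fderiv ℝ (fderiv ℝ f) (y + t • d) u u * (1 - l * t) ^ 2 ≤ fderiv ℝ (fderiv ℝ f) y u u ∧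
      fderiv ℝ (fderiv ℝ f) y u u * (1 - l * t) ^ 2 ≤ fderiv ℝ (fderiv ℝ f) (y + t • d) u u := by
  have h := mul_sq_le_and_mul_sq_le_of_abs_deriv_le hs hl0 hls
    (fun t ht => hf.hasDerivAt_fderiv_fderiv_line (hD t ht) u u)
    (fun t ht => (hf.abs_third_fderiv_le hpos (hD t ht) u d).trans (by
      gcongr
      · exact fderiv_fderiv_nonneg hpos (hD t ht) u
      · exact hf.sqrt_fderiv_fderiv_line_le hpos hs hl0 hls hD hl t ht))
  simpa using h

lemma fderiv_line_sub_le (hf : SelfConcordantOn f D)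
    (hpos : ∀ y ∈ D, ∀ u : E, u ≠ 0 → 0 < fderiv ℝ (fderiv ℝ f) y u u)
    (hs : 0 ≤ s) (hl0 : 0 ≤ l) (hls : l * s < 1) (hD : ∀ t ∈ Set.Icc 0 s, y + t • d ∈ D)
    (hl : √(fderiv ℝ (fderiv ℝ f) y d d) ≤ l) (u : E) :
    fderiv ℝ f (y + s • d) u - fderiv ℝ f y u ≤
      √(fderiv ℝ (fderiv ℝ f) y u u) * ((1 - l * s)⁻¹ - 1) := by
  have hlt : ∀ x ∈ Set.Icc 0 s, 0 < 1 - l * x := fun x hx => by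
    linarith [mul_le_mul_of_nonneg_left hx.2 hl0]
  set q := √(fderiv ℝ (fderiv ℝ f) y u u) with hq
  have hder : ∀ x ∈ Set.Icc 0 s,
      HasDerivAt (fun x : ℝ => q * (1 - l * x)⁻¹ - fderiv ℝ f (y + x • d) u)
        (q * (l / (1 - l * x) ^ 2) - fderiv ℝ (fderiv ℝ f) (y + x • d) d u) x := by
    intro x hx
    have h1 : HasDerivAt (fun x : ℝ => 1 - l * x) (-l) x := by
      simpa using ((hasDerivAt_id x).const_mul l).const_sub 1
    have h2 := (h1.fun_inv (hlt x hx).ne').const_mul q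
    rw [neg_neg] at h2
    exact h2.sub (hf.hasDerivAt_fderiv_line (hD x hx) u)
  have h := monotoneOn_of_hasDerivWithinAt_nonneg (convex_Icc 0 s)
    (fun x hx => (hder x hx).continuousAt.continuousWithinAt)
    (fun x hx => (hder x (interior_subset hx)).hasDerivWithinAt)
    (fun x hx => by
      have hx := interior_subset hx
      have h0 := hlt x hx
      have h1 := (le_abs_self _).trans (apply_le_sqrt_mul_sqrt (hf.fderiv_fderiv_symm (hD x hx))
        (fderiv_fderiv_nonneg hpos (hD x hx)) d u)
      have h2 := hf.sqrt_fderiv_fderiv_line_le hpos hs hl0 hls hD hl x hx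
      have h3 : √(fderiv ℝ (fderiv ℝ f) (y + x • d) u u) ≤ q / (1 - l * x) := by
        rw [le_div_iff₀ h0, ← Real.sqrt_sq h0.le, ← Real.sqrt_mul
          (fderiv_fderiv_nonneg hpos (hD x hx) u)]
        exact Real.sqrt_le_sqrt
          (hf.fderiv_fderiv_line_le_and_le hpos hs hl0 hls hD hl u x hx).1
      rw [sub_nonneg]
      calc _ ≤ _ := h1
        _ ≤ l / (1 - l * x) * (q / (1 - l * x)) := by gcongr
        _ = _ := by field_simp)
    (Set.left_mem_Icc.2 hs) (Set.right_mem_Icc.2 hs) hs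
  simp only [mul_zero, sub_zero, inv_one, mul_one, zero_smul, add_zero] at h
  linarith

lemma line_le (hf : SelfConcordantOn f D)
    (hpos : ∀ y ∈ D, ∀ u : E, u ≠ 0 → 0 < fderiv ℝ (fderiv ℝ f) y u u)
    (hs : 0 ≤ s) (hl0 : 0 ≤ l) (hls : l * s < 1) (hD : ∀ t ∈ Set.Icc 0 s, y + t • d ∈ D)
    (hl : √(fderiv ℝ (fderiv ℝ f) y d d) ≤ l) :
    f (y + s • d) ≤ f y + s * (|fderiv ℝ f y d| + l * (1 - l * s)⁻¹) := by
  have hlt : ∀ x ∈ Set.Icc 0 s, 0 < 1 - l * x := fun x hx => by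
    linarith [mul_le_mul_of_nonneg_left hx.2 hl0]
  have hder : ∀ x ∈ Set.Icc 0 s,
      HasDerivAt (fun x : ℝ => f (y + x • d)) (fderiv ℝ f (y + x • d) d) x := fun x hx =>
    hasDerivAt_comp_line ((hf.contDiffAt (hD x hx)).differentiableAt (by norm_num))
  have h := (convex_Icc 0 s).image_sub_le_mul_sub_of_deriv_le
    (fun x hx => (hder x hx).continuousAt.continuousWithinAt)
    (fun x hx => (hder x (interior_subset hx)).differentiableAt.differentiableWithinAt)
    (C := |fderiv ℝ f y d| + l * (1 - l * s)⁻¹) (fun x hx => by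
      have hx := interior_subset hx
      rw [(hder x hx).deriv]
      have h1 := hf.fderiv_line_sub_le hpos hx.1 hl0
        (by linarith [hlt x hx]) (fun t ht => hD t ⟨ht.1, ht.2.trans hx.2⟩) hl d
      have h2 : √(fderiv ℝ (fderiv ℝ f) y d d) * ((1 - l * x)⁻¹ - 1) ≤ l * (1 - l * s)⁻¹ := by
        have h3 : (1 - l * x)⁻¹ ≤ (1 - l * s)⁻¹ :=
          inv_anti₀ (hlt s (Set.right_mem_Icc.2 hs)) (by linarith [mul_le_mul_of_nonneg_left hx.2 hl0])
        have h4 : 0 ≤ (1 - l * x)⁻¹ - 1 := by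
          rw [sub_nonneg]
          exact (one_le_inv₀ (hlt x hx)).2 (by linarith [mul_nonneg hl0 hx.1])
        exact mul_le_mul hl (by linarith) h4 hl0
      linarith [le_abs_self (fderiv ℝ f y d)])
    0 (Set.left_mem_Icc.2 hs) s (Set.right_mem_Icc.2 hs) hs
  simp only [zero_smul, add_zero, sub_zero] at h
  linarith

lemma add_smul_mem (hf : SelfConcordantOn f D)
    (hpos : ∀ y ∈ D, ∀ u : E, u ≠ 0 → 0 < fderiv ℝ (fderiv ℝ f) y u u)
    (hbar : ∀ z ∈ frontier D, ∀ u : ℕ → E, (∀ i, u i ∈ D) →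
      Filter.Tendsto u Filter.atTop (nhds z) →
      Filter.Tendsto (fun i => f (u i)) Filter.atTop Filter.atTop)
    (hy : y ∈ D) (hl0 : 0 ≤ l) (hl1 : l < 1)
    (hl : √(fderiv ℝ (fderiv ℝ f) y d d) ≤ l) :
    ∀ t ∈ Set.Icc (0 : ℝ) 1, y + t • d ∈ D := by
  by_contra! hcon
  obtain ⟨t₁, ht₁, hnot⟩ := hcon
  have hcont : Continuous fun t : ℝ => y + t • d := by fun_prop
  set S := Set.Icc (0 : ℝ) 1 ∩ (fun t : ℝ => y + t • d) ⁻¹' Dᶜ with hS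
  have hSc : IsCompact S := isCompact_Icc.inter_right (hf.1.isClosed_compl.preimage hcont)
  obtain ⟨s, ⟨hs, hsD⟩, hmin⟩ := hSc.exists_isLeast ⟨t₁, ht₁, hnot⟩
  have hs0 : 0 < s := hs.1.lt_of_ne fun h => hsD (by simpa [← h] using hy)
  have hlt : ∀ t, 0 ≤ t → t < s → y + t • d ∈ D := fun t h0 h1 => by
    by_contra hc
    exact absurd (hmin ⟨⟨h0, (h1.trans_le hs.2).le⟩, hc⟩) (not_le.2 h1)
  obtain ⟨u, -, hu, hus⟩ := exists_seq_strictMono_tendsto' hs0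
  have htend : Filter.Tendsto (fun n => y + u n • d) Filter.atTop (nhds (y + s • d)) :=
    (hcont.tendsto s).comp hus
  have huD : ∀ n, y + u n • d ∈ D := fun n => hlt _ (hu n).1.le (hu n).2
  have hfr : y + s • d ∈ frontier D := by
    rw [hf.1.frontier_eq]
    exact ⟨mem_closure_of_tendsto htend (Filter.Eventually.of_forall huD), hsD⟩
  have hlim := hbar _ hfr _ huD htend
  obtain ⟨n, hn⟩ := (hlim.eventually_gt_atTop
    (f y + (|fderiv ℝ f y d| + l * (1 - l)⁻¹))).exists
  have hu0 := (hu n).1.le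
  have hu1 := (hu n).2.le.trans hs.2
  have hlu : l * u n ≤ l := mul_le_of_le_one_right hl0 hu1
  have hb := hf.line_le hpos hu0 hl0 (hlu.trans_lt hl1)
    (fun t ht => hlt t ht.1 (ht.2.trans_lt (hu n).2)) hl
  have h1 : (1 - l * u n)⁻¹ ≤ (1 - l)⁻¹ := inv_anti₀ (by linarith) (by linarith)
  have h2 : 0 ≤ (1 - l * u n)⁻¹ := inv_nonneg.2 (by linarith)
  have h3 : u n * (|fderiv ℝ f y d| + l * (1 - l * u n)⁻¹) ≤
      |fderiv ℝ f y d| + l * (1 - l)⁻¹ :=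
    (mul_le_of_le_one_left (by positivity) hu1).trans (by gcongr)
  linarith

end Line

end SelfConcordantOn

end

/-- Lemma 4.3 of the paper. Let `ψ` be self-concordant on `D` with positive
definite Hessians, blowing up along sequences converging to boundary points of `D`.  If
`d̄ = [∇²ψ(ȳ)]⁻¹ ∇ψ(ȳ)` has Newton decrement `λ̄ = ⟨∇ψ(ȳ), d̄⟩^{1/2} ≤ β < 1`, then the
backward Newton step `ŷ = ȳ + d̄` lies in `D` and its Newton decrement (dual local norm of the
gradient at `ŷ`, computed with any two-sided inverse `Binv` of the Hessian at `ŷ`) is at most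
`(2β - β²)/(1 - β)²`. -/
theorem stmt1 {E : Type*} [NormedAddCommGroup E] [InnerProductSpace ℝ E]
    [FiniteDimensional ℝ E]
    (ψ : E → ℝ) (D : Set E) (hψ : SelfConcordantOn ψ D)
    (hpos : ∀ y ∈ D, ∀ u : E, u ≠ 0 → 0 < ⟪hessOp ψ y u, u⟫)
    (hbar : ∀ z ∈ frontier D, ∀ u : ℕ → E, (∀ i, u i ∈ D) →
      Filter.Tendsto u Filter.atTop (nhds z) →
      Filter.Tendsto (fun i => ψ (u i)) Filter.atTop Filter.atTop)
    (yb : E) (hyb : yb ∈ D)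
    (db : E) (hdb : hessOp ψ yb db = gradient ψ yb)
    (β : ℝ) (hβ : β ∈ Set.Ioo (0 : ℝ) 1)
    (hlam : Real.sqrt ⟪gradient ψ yb, db⟫ ≤ β) :
    yb + db ∈ D ∧
      ∀ Binv : E →ₗ[ℝ] E,
        (∀ u : E, Binv (hessOp ψ (yb + db) u) = u ∧ hessOp ψ (yb + db) (Binv u) = u) →
        Real.sqrt ⟪gradient ψ (yb + db), Binv (gradient ψ (yb + db))⟫
          ≤ (2 * β - β ^ 2) / (1 - β) ^ 2 := by
  obtain ⟨hβ0, hβ1⟩ := hβ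
  have hQ : ∀ y ∈ D, ∀ u v : E, ⟪hessOp ψ y u, v⟫ = fderiv ℝ (fderiv ℝ ψ) y u v :=
    fun y hy => inner_hessOp_apply (hψ.differentiableAt_fderiv hy)
  have hpos' : ∀ y ∈ D, ∀ u : E, u ≠ 0 → 0 < fderiv ℝ (fderiv ℝ ψ) y u u := fun y hy u hu => by
    rw [← hQ y hy]
    exact hpos y hy u hu
  have hl : √(fderiv ℝ (fderiv ℝ ψ) yb db db) ≤ β := by
    rwa [← hQ yb hyb, hdb]
  have hmem := hψ.add_smul_mem hpos' hbar hyb hβ0.le hβ1 hl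
  have h1mem : (1 : ℝ) ∈ Set.Icc (0 : ℝ) 1 := ⟨zero_le_one, le_rfl⟩
  have hyD : yb + db ∈ D := by simpa using hmem 1 h1mem
  refine ⟨hyD, fun Binv hB => ?_⟩
  set u := Binv (gradient ψ (yb + db)) with hu
  have hgu : hessOp ψ (yb + db) u = gradient ψ (yb + db) := (hB _).2
  have hgrad := hψ.fderiv_line_sub_le hpos' zero_le_one hβ0.le (by linarith) hmem hl u
  have hcomp := (hψ.fderiv_fderiv_line_le_and_le hpos' zero_le_one hβ0.le (by linarith)
    hmem hl u 1 h1mem).2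
  have hcs := (le_abs_self _).trans (apply_le_sqrt_mul_sqrt (hψ.fderiv_fderiv_symm hyb)
    (SelfConcordantOn.fderiv_fderiv_nonneg hpos' hyb) db u)
  have hnn := SelfConcordantOn.fderiv_fderiv_nonneg hpos' hyD u
  have hself : fderiv ℝ ψ (yb + db) u = fderiv ℝ (fderiv ℝ ψ) (yb + db) u u := by
    rw [← hQ _ hyD, hgu, inner_gradient_apply]
  rw [← hQ yb hyb, hdb, inner_gradient_apply] at hcs
  rw [inner_gradient_apply, hself]
  simp only [one_smul, mul_one, hself] at hgrad hcomp
  set n := √(fderiv ℝ (fderiv ℝ ψ) (yb + db) u u) with hn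
  set q := √(fderiv ℝ (fderiv ℝ ψ) yb u u) with hq
  have hn2 : n * n = fderiv ℝ (fderiv ℝ ψ) (yb + db) u u := Real.mul_self_sqrt hnn
  have hn0 : 0 ≤ n := Real.sqrt_nonneg _
  have hq0 : 0 ≤ q := Real.sqrt_nonneg _
  have hβ' : 0 < 1 - β := by linarith
  have hqn : q * (1 - β) ≤ n := by
    have h := Real.sqrt_le_sqrt hcomp
    rwa [Real.sqrt_mul (SelfConcordantOn.fderiv_fderiv_nonneg hpos' hyb u),
      Real.sqrt_sq hβ'.le] at h
  have hqn' : q ≤ n / (1 - β) := (le_div_iff₀ hβ').2 hqn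
  have hc0 : 0 ≤ (2 * β - β ^ 2) / (1 - β) := div_nonneg (by nlinarith) hβ'.le
  have hmain : n * n ≤ (2 * β - β ^ 2) / (1 - β) ^ 2 * n := by
    calc n * n ≤ β * q + q * ((1 - β)⁻¹ - 1) := by
          rw [hn2]
          linarith [mul_le_mul_of_nonneg_right hl hq0]
      _ = (2 * β - β ^ 2) / (1 - β) * q := by field_simp; ring
      _ ≤ (2 * β - β ^ 2) / (1 - β) * (n / (1 - β)) := by gcongr
      _ = _ := by field_simp
  rcases hn0.eq_or_lt with h | h
  · rw [← h]
    exact div_nonneg (by nlinarith) (by positivity)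
  · exact le_of_mul_le_mul_right hmain h
end
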